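/- Suppose ε > 0, c₁, c₂ > 0, and (Z_n)_{n≥2} is a sequence of finite connected simple graphs such that every vertex of Z_n has degree 2 or 3, c₁·n ≤ #V(Z_n) ≤ c₂·n, and λ1(Z_n) ≥ ε for all n. Then there exist a constant C > 0 and a sequence (Y_n, p_n)_{n≥2} of finite connected simple graphs with a distinguished vertex p_n, such that for all n ≥ 2: (i) every vertex of Y_n has degree at most 3; (ii) C⁻¹·n¹¹ ≤ #E(Y_n) ≤ C·n¹¹; (iii) C⁻¹·n¹⁰·log n ≤ diam Y_n ≤ C·n¹⁰·log n; (iv) C⁻¹·n⁻²⁰ ≤ λ1(Y_n) ≤ C·n⁻²⁰; and (v) for every natural number k, the number of vertices v of Y_n with d(p_n, v) = k is at most C·n. -/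

import Mathlib

noncomputable section

open scoped Classical in
/-- The Rayleigh quotient `R_X(f) = (½ ∑_{x∼y} (f x − f y)²) / (∑_x f x²)`,
where the numerator sum runs over ordered pairs of adjacent vertices. -/
def rayleighQuot {V : Type} [Fintype V] (G : SimpleGraph V) (f : V → ℝ) : ℝ :=
  (2⁻¹ * ∑ x : V, ∑ y : V, if G.Adj x y then (f x - f y) ^ 2 else 0) / ∑ x : V, (f x) ^ 2

/-- The spectral gap `λ₁(X)`, i.e. the smallest Rayleigh quotient of a nonzero
function of mean zero; for finite connected graphs this is the second-smallest
eigenvalue of the combinatorial Laplacian. -/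
def spectralGap {V : Type} [Fintype V] (G : SimpleGraph V) : ℝ :=
  sInf {r : ℝ | ∃ f : V → ℝ, f ≠ 0 ∧ (∑ x : V, f x) = 0 ∧ rayleighQuot G f = r}

open Finset in
open scoped Classical in
lemma sum_adj_eq_sum_dart {V : Type} [Fintype V] (G : SimpleGraph V) (F : V → V → ℝ) :
    (∑ x : V, ∑ y : V, if G.Adj x y then F x y else 0) = ∑ d : G.Dart, F d.fst d.snd := by
  rw [← Fintype.sum_prod_type' (f := fun x y => if G.Adj x y then F x y else 0),
    ← Finset.sum_filter]
  symm
  refine Finset.sum_bij (fun d _ => d.toProd) ?_ ?_ ?_ ?_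
  · intro d _
    simp
  · intro a _ b _ h
    exact SimpleGraph.Dart.ext _ _ h
  · rintro ⟨x, y⟩ h
    exact ⟨⟨(x, y), by simpa using h⟩, Finset.mem_univ _, rfl⟩
  · intro d _
    rfl

namespace SimpleGraph

variable {V : Type} (G : SimpleGraph V) (m : ℕ)

/-- The `j`-th vertex on the path of length `2 * m + 1` replacing the dart `d`. The inner vertices
are the pairs `(d, i)` with `i < m` on the half of the path near `d.fst`, followed by the vertices
`(d.symm, i)` on the other half. -/
def pathPoint (d : G.Dart) (j : ℕ) : V ⊕ G.Dart × Fin m :=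
  if j = 0 then Sum.inl d.fst
  else if h : j - 1 < m then Sum.inr (d, ⟨j - 1, h⟩)
  else if h : 2 * m - j < m ∧ j ≤ 2 * m then Sum.inr (d.symm, ⟨2 * m - j, h.1⟩)
  else Sum.inl d.snd

variable {G m}

lemma pathPoint_zero (d : G.Dart) : G.pathPoint m d 0 = Sum.inl d.fst := by
  simp [pathPoint]

lemma pathPoint_end (d : G.Dart) : G.pathPoint m d (2 * m + 1) = Sum.inl d.snd := by
  simp [pathPoint]
  omega

lemma pathPoint_succ (d : G.Dart) (i : Fin m) :
    G.pathPoint m d (i + 1) = Sum.inr (d, i) := by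
  simp [pathPoint]

lemma pathPoint_symm (d : G.Dart) {j : ℕ} (hj : j ≤ 2 * m + 1) :
    G.pathPoint m d.symm (2 * m + 1 - j) = G.pathPoint m d j := by
  unfold pathPoint
  split_ifs <;> first
    | omega
    | rfl
    | (simp only [Dart.symm_symm, Sum.inr.injEq, Prod.mk.injEq, Fin.mk.injEq, true_and]
       try omega)

variable (G m) in
/-- The graph obtained from `G` by replacing every edge by a path of length `2 * m + 1`. -/
def subdivide : SimpleGraph (V ⊕ G.Dart × Fin m) where
  Adj x y := x ≠ y ∧ ∃ d : G.Dart, ∃ j < 2 * m + 1, x = G.pathPoint m d j ∧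
    y = G.pathPoint m d (j + 1)
  symm := by
    constructor
    rintro x y ⟨hne, d, j, hj, rfl, rfl⟩
    refine ⟨hne.symm, d.symm, 2 * m - j, by omega, ?_, ?_⟩
    · rw [← pathPoint_symm d (by omega : j + 1 ≤ 2 * m + 1)]
      congr 1
      omega
    · rw [← pathPoint_symm d (by omega : j ≤ 2 * m + 1)]
      congr 1
      omega
  loopless := ⟨fun x h => h.1 rfl⟩

lemma pathPoint_cases (d : G.Dart) {j : ℕ} (hj : j ≤ 2 * m + 1) :
    (j = 0 ∧ G.pathPoint m d j = Sum.inl d.fst) ∨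
    (∃ i : Fin m, j = i + 1 ∧ G.pathPoint m d j = Sum.inr (d, i)) ∨
    (∃ i : Fin m, j + i = 2 * m ∧ G.pathPoint m d j = Sum.inr (d.symm, i)) ∨
    (j = 2 * m + 1 ∧ G.pathPoint m d j = Sum.inl d.snd) := by
  rcases Nat.eq_zero_or_pos j with rfl | h0
  · exact Or.inl ⟨rfl, pathPoint_zero d⟩
  by_cases h1 : j ≤ m
  · refine Or.inr (Or.inl ⟨⟨j - 1, by omega⟩, by simp; omega, ?_⟩)
    rw [← pathPoint_succ]
    congr 1
    simp; omega
  by_cases h2 : j ≤ 2 * m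
  · refine Or.inr (Or.inr (Or.inl ⟨⟨2 * m - j, by omega⟩, by simp; omega, ?_⟩))
    rw [← pathPoint_succ, ← pathPoint_symm d hj]
    congr 1
    simp; omega
  · have : j = 2 * m + 1 := by omega
    subst this
    exact Or.inr (Or.inr (Or.inr ⟨rfl, pathPoint_end d⟩))

lemma pathPoint_pair_injective (hm : 0 < m) {d d' : G.Dart} {j j' : ℕ} (hj : j < 2 * m + 1)
    (hj' : j' < 2 * m + 1) (h : G.pathPoint m d j = G.pathPoint m d' j')
    (h' : G.pathPoint m d (j + 1) = G.pathPoint m d' (j' + 1)) : d = d' ∧ j = j' := by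
  have hs : ∀ e : G.Dart, e.symm ≠ e := Dart.symm_ne
  rcases pathPoint_cases (m := m) d (j := j) (by omega) with ⟨h1, e1⟩ | ⟨i1, h1, e1⟩ | ⟨i1, h1, e1⟩ | ⟨h1, e1⟩ <;>
  rcases pathPoint_cases (m := m) d' (j := j') (by omega) with ⟨h2, e2⟩ | ⟨i2, h2, e2⟩ | ⟨i2, h2, e2⟩ | ⟨h2, e2⟩ <;>
  rcases pathPoint_cases (m := m) d (j := j + 1) (by omega) with ⟨h3, e3⟩ | ⟨i3, h3, e3⟩ | ⟨i3, h3, e3⟩ | ⟨h3, e3⟩ <;>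
  rcases pathPoint_cases (m := m) d' (j := j' + 1) (by omega) with ⟨h4, e4⟩ | ⟨i4, h4, e4⟩ | ⟨i4, h4, e4⟩ | ⟨h4, e4⟩ <;>
  first
  | omega
  | (rw [e1, e2] at h
     rw [e3, e4] at h'
     simp only [reduceCtorEq, Sum.inr.injEq, Prod.mk.injEq] at h h' <;> grind [Dart.symm_symm])

lemma pathPoint_ne_succ (hm : 0 < m) (d : G.Dart) {j : ℕ} (hj : j < 2 * m + 1) :
    G.pathPoint m d j ≠ G.pathPoint m d (j + 1) := by
  have hs : d.symm ≠ d := d.symm_ne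
  intro h
  rcases pathPoint_cases (m := m) d (j := j) (by omega) with ⟨h1, e1⟩ | ⟨i1, h1, e1⟩ | ⟨i1, h1, e1⟩ | ⟨h1, e1⟩ <;>
  rcases pathPoint_cases (m := m) d (j := j + 1) (by omega) with ⟨h3, e3⟩ | ⟨i3, h3, e3⟩ | ⟨i3, h3, e3⟩ | ⟨h3, e3⟩ <;>
  first
  | omega
  | (rw [e1, e3] at h
     simp only [reduceCtorEq, Sum.inr.injEq, Prod.mk.injEq] at h <;> grind)

lemma subdivide_adj_pathPoint (hm : 0 < m) (d : G.Dart) {j : ℕ} (hj : j < 2 * m + 1) :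
    (G.subdivide m).Adj (G.pathPoint m d j) (G.pathPoint m d (j + 1)) :=
  ⟨pathPoint_ne_succ hm d hj, d, j, hj, rfl, rfl⟩

open scoped Classical in
lemma sum_subdivide_adj [Fintype V] (hm : 0 < m)
    (F : V ⊕ G.Dart × Fin m → V ⊕ G.Dart × Fin m → ℝ) :
    (∑ x, ∑ y, if (G.subdivide m).Adj x y then F x y else 0) =
      ∑ d : G.Dart, ∑ j ∈ Finset.range (2 * m + 1),
        F (G.pathPoint m d j) (G.pathPoint m d (j + 1)) := by
  rw [← Fintype.sum_prod_type' (f := fun x y => if (G.subdivide m).Adj x y then F x y else 0),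
    ← Finset.sum_filter, ← Finset.sum_product']
  symm
  refine Finset.sum_bij (fun p _ => (G.pathPoint m p.1 p.2, G.pathPoint m p.1 (p.2 + 1)))
    ?_ ?_ ?_ ?_
  · rintro ⟨d, j⟩ h
    simp only [Finset.mem_product, Finset.mem_univ, true_and, Finset.mem_range] at h
    simpa using subdivide_adj_pathPoint hm d h
  · rintro ⟨d, j⟩ h ⟨d', j'⟩ h' he
    simp only [Finset.mem_product, Finset.mem_univ, true_and, Finset.mem_range] at h h'
    simp only [Prod.mk.injEq] at he ⊢
    exact pathPoint_pair_injective hm h h' he.1 he.2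
  · rintro ⟨x, y⟩ h
    simp only [Finset.mem_filter, Finset.mem_univ, true_and] at h
    obtain ⟨-, d, j, hj, rfl, rfl⟩ := h
    exact ⟨(d, j), by simpa using hj, rfl⟩
  · intro p _
    rfl

end SimpleGraph

open scoped Classical in
/-- The Dirichlet energy, the numerator of the Rayleigh quotient. -/
def dirichletEnergy {V : Type} [Fintype V] (G : SimpleGraph V) (f : V → ℝ) : ℝ :=
  2⁻¹ * ∑ x : V, ∑ y : V, if G.Adj x y then (f x - f y) ^ 2 else 0

lemma rayleighQuot_eq {V : Type} [Fintype V] (G : SimpleGraph V) (f : V → ℝ) :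
    rayleighQuot G f = dirichletEnergy G f / ∑ x : V, (f x) ^ 2 := rfl

lemma dirichletEnergy_nonneg {V : Type} [Fintype V] (G : SimpleGraph V) (f : V → ℝ) :
    0 ≤ dirichletEnergy G f := by
  unfold dirichletEnergy
  refine mul_nonneg (by norm_num) (Finset.sum_nonneg fun x _ => Finset.sum_nonneg fun y _ => ?_)
  split_ifs
  · positivity
  · exact le_rfl

lemma sum_sq_pos {V : Type} [Fintype V] {f : V → ℝ} (hf : f ≠ 0) : 0 < ∑ x : V, (f x) ^ 2 := by
  obtain ⟨x, hx⟩ := Function.ne_iff.mp hf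
  exact Finset.sum_pos' (fun _ _ => sq_nonneg _) ⟨x, Finset.mem_univ _, by
    have : f x ≠ 0 := hx
    positivity⟩

lemma spectralGap_le {V : Type} [Fintype V] (G : SimpleGraph V) {f : V → ℝ} (hf : f ≠ 0)
    (hsum : ∑ x : V, f x = 0) : spectralGap G ≤ rayleighQuot G f := by
  refine csInf_le ⟨0, ?_⟩ ⟨f, hf, hsum, rfl⟩
  rintro r ⟨g, -, -, rfl⟩
  exact div_nonneg (dirichletEnergy_nonneg G g) (Finset.sum_nonneg fun _ _ => sq_nonneg _)

lemma mul_sum_sq_le_dirichletEnergy {V : Type} [Fintype V] {G : SimpleGraph V} {ε : ℝ}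
    (hG : ε ≤ spectralGap G) (f : V → ℝ) (hsum : ∑ x : V, f x = 0) :
    ε * ∑ x : V, (f x) ^ 2 ≤ dirichletEnergy G f := by
  by_cases hf : f = 0
  · subst hf
    simpa using dirichletEnergy_nonneg G 0
  · have := hG.trans (spectralGap_le G hf hsum)
    rwa [rayleighQuot_eq, le_div_iff₀ (sum_sq_pos hf)] at this

lemma le_spectralGap {V : Type} [Fintype V] {G : SimpleGraph V} {a : ℝ}
    (hne : ∃ f : V → ℝ, f ≠ 0 ∧ ∑ x : V, f x = 0)
    (h : ∀ f : V → ℝ, ∑ x : V, f x = 0 → a * ∑ x : V, (f x) ^ 2 ≤ dirichletEnergy G f) :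
    a ≤ spectralGap G := by
  obtain ⟨f₀, hf₀, hs₀⟩ := hne
  refine le_csInf ⟨_, f₀, hf₀, hs₀, rfl⟩ ?_
  rintro r ⟨f, hf, hs, rfl⟩
  rw [rayleighQuot_eq, le_div_iff₀ (sum_sq_pos hf)]
  exact h f hs

lemma sq_sub_zero_le_mul_sum_sq (a : ℕ → ℝ) {j n : ℕ} (hj : j ≤ n) :
    (a j - a 0) ^ 2 ≤ n * ∑ i ∈ Finset.range n, (a i - a (i + 1)) ^ 2 := by
  have h1 : a j - a 0 = ∑ i ∈ Finset.range j, (a (i + 1) - a i) := (Finset.sum_range_sub a j).symm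
  have h2 : ∑ i ∈ Finset.range j, (a (i + 1) - a i) ^ 2
      ≤ ∑ i ∈ Finset.range n, (a i - a (i + 1)) ^ 2 := by
    simp only [sub_sq_comm (a (_ + 1))]
    exact Finset.sum_le_sum_of_subset_of_nonneg (by simpa using hj) fun _ _ _ => sq_nonneg _
  calc (a j - a 0) ^ 2 ≤ j * ∑ i ∈ Finset.range j, (a (i + 1) - a i) ^ 2 := by
        rw [h1]
        simpa using sq_sum_le_card_mul_sum_sq (s := Finset.range j) (f := fun i => a (i + 1) - a i)
    _ ≤ n * ∑ i ∈ Finset.range n, (a i - a (i + 1)) ^ 2 := by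
        gcongr

open scoped Classical in
lemma dirichletEnergy_eq_sum_dart {V : Type} [Fintype V] (G : SimpleGraph V) (f : V → ℝ) :
    dirichletEnergy G f = 2⁻¹ * ∑ d : G.Dart, (f d.fst - f d.snd) ^ 2 := by
  rw [dirichletEnergy, sum_adj_eq_sum_dart G (fun x y => (f x - f y) ^ 2)]

open scoped Classical in
lemma sum_dart_fst {V : Type} [Fintype V] (G : SimpleGraph V) (g : V → ℝ) :
    ∑ d : G.Dart, g d.fst = ∑ x : V, (G.neighborSet x).ncard * g x := by
  rw [← sum_adj_eq_sum_dart G (fun x _ => g x)]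
  refine Finset.sum_congr rfl fun x _ => ?_
  rw [← Finset.sum_filter, Finset.sum_const, nsmul_eq_mul]
  congr 2
  rw [← Set.ncard_coe_finset]
  congr 1
  ext y
  simp

namespace SimpleGraph

variable {V : Type} {G : SimpleGraph V} {m : ℕ}

open scoped Classical in
lemma dirichletEnergy_subdivide [Fintype V] (hm : 0 < m) (f : V ⊕ G.Dart × Fin m → ℝ) :
    dirichletEnergy (G.subdivide m) f = 2⁻¹ * ∑ d : G.Dart, ∑ j ∈ Finset.range (2 * m + 1),
      (f (G.pathPoint m d j) - f (G.pathPoint m d (j + 1))) ^ 2 := by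
  rw [dirichletEnergy, sum_subdivide_adj hm (fun x y => (f x - f y) ^ 2)]

open scoped Classical in
lemma dirichletEnergy_inl_le [Fintype V] (hm : 0 < m) (f : V ⊕ G.Dart × Fin m → ℝ) :
    dirichletEnergy G (fun v => f (Sum.inl v)) ≤
      (2 * m + 1) * dirichletEnergy (G.subdivide m) f := by
  rw [dirichletEnergy_eq_sum_dart, dirichletEnergy_subdivide hm, mul_left_comm]
  refine mul_le_mul_of_nonneg_left ?_ (by norm_num)
  rw [Finset.mul_sum]
  refine Finset.sum_le_sum fun d _ => ?_
  have := sq_sub_zero_le_mul_sum_sq (fun j => f (G.pathPoint m d j)) (le_refl (2 * m + 1))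
  simp only [pathPoint_zero, pathPoint_end] at this
  rw [sub_sq_comm]
  exact_mod_cast this

open scoped Classical in
lemma sum_sq_inr_sub_inl_le [Fintype V] (hm : 0 < m) (f : V ⊕ G.Dart × Fin m → ℝ) :
    ∑ d : G.Dart, ∑ i : Fin m, (f (Sum.inr (d, i)) - f (Sum.inl d.fst)) ^ 2 ≤
      2 * m * (2 * m + 1) * dirichletEnergy (G.subdivide m) f := by
  rw [dirichletEnergy_subdivide hm]
  set E : G.Dart → ℝ := fun d => ∑ j ∈ Finset.range (2 * m + 1),
      (f (G.pathPoint m d j) - f (G.pathPoint m d (j + 1))) ^ 2 with hE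
  have key : ∀ d : G.Dart, ∑ i : Fin m, (f (Sum.inr (d, i)) - f (Sum.inl d.fst)) ^ 2 ≤
      m * ((2 * m + 1) * E d) := by
    intro d
    have : ∀ i : Fin m, (f (Sum.inr (d, i)) - f (Sum.inl d.fst)) ^ 2 ≤ (2 * m + 1) * E d := by
      intro i
      have := sq_sub_zero_le_mul_sum_sq (fun j => f (G.pathPoint m d j))
        (by omega : (i : ℕ) + 1 ≤ 2 * m + 1)
      simp only [pathPoint_zero, pathPoint_succ] at this
      exact_mod_cast this
    simpa using Finset.sum_le_sum (s := Finset.univ) fun i _ => this i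
  calc _ ≤ ∑ d, m * ((2 * m + 1) * E d) := Finset.sum_le_sum fun d _ => key d
    _ = _ := by
      rw [← Finset.mul_sum, ← Finset.mul_sum]
      ring

open scoped Classical in
lemma sum_sq_le_sum_sq_sub {ι : Type} [Fintype ι] (f : ι → ℝ) (hf : ∑ x, f x = 0) (c : ℝ) :
    ∑ x, (f x) ^ 2 ≤ ∑ x, (f x - c) ^ 2 := by
  have : ∑ x, (f x - c) ^ 2 = ∑ x, (f x) ^ 2 - 2 * c * ∑ x, f x + ∑ _x : ι, c ^ 2 := by
    rw [Finset.mul_sum, ← Finset.sum_sub_distrib, ← Finset.sum_add_distrib]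
    exact Finset.sum_congr rfl fun x _ => by ring
  rw [this, hf]
  have : 0 ≤ ∑ _x : ι, c ^ 2 := Finset.sum_nonneg fun _ _ => sq_nonneg c
  linarith

open scoped Classical in
lemma sum_sq_le_dirichletEnergy_subdivide [Fintype V] [Nonempty V] {ε : ℝ} (hε : 0 < ε)
    (hG : ε ≤ spectralGap G) (hdeg : ∀ v, (G.neighborSet v).ncard ≤ 3) (hm : 0 < m)
    (f : V ⊕ G.Dart × Fin m → ℝ) (hf : ∑ x, f x = 0) :
    ∑ x, (f x) ^ 2 ≤ (21 / ε + 12) * m ^ 2 * dirichletEnergy (G.subdivide m) f := by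
  set g : V → ℝ := fun v => f (Sum.inl v) with hg
  set c : ℝ := (∑ v, g v) / Fintype.card V with hc
  set E := dirichletEnergy (G.subdivide m) f with hE
  have hE0 : 0 ≤ E := dirichletEnergy_nonneg _ _
  have hm1 : (1 : ℝ) ≤ m := by exact_mod_cast hm
  have hN : (Fintype.card V : ℝ) ≠ 0 := by exact_mod_cast Fintype.card_ne_zero
  have hmean : ∑ v, (g v - c) = 0 := by
    rw [Finset.sum_sub_distrib, Finset.sum_const, Finset.card_univ, nsmul_eq_mul, hc]
    field_simp
    ring
  have hgap := mul_sum_sq_le_dirichletEnergy hG _ hmean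
  have htrans : dirichletEnergy G (fun v => g v - c) = dirichletEnergy G g := by
    simp [dirichletEnergy]
  rw [htrans] at hgap
  have hS : ∑ v, (g v - c) ^ 2 ≤ (2 * m + 1) / ε * E := by
    rw [div_mul_eq_mul_div, le_div_iff₀ hε, mul_comm]
    exact hgap.trans (dirichletEnergy_inl_le hm f)
  have hdart : ∑ d : G.Dart, (g d.fst - c) ^ 2 ≤ 3 * ∑ v, (g v - c) ^ 2 := by
    rw [sum_dart_fst G (fun v => (g v - c) ^ 2), Finset.mul_sum]
    gcongr with v
    exact_mod_cast hdeg v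
  have hin := sum_sq_inr_sub_inl_le hm f
  have hsplit : ∑ d : G.Dart, ∑ i : Fin m, (f (Sum.inr (d, i)) - c) ^ 2 ≤
      2 * ∑ d : G.Dart, ∑ i : Fin m, (f (Sum.inr (d, i)) - f (Sum.inl d.fst)) ^ 2 +
        2 * m * ∑ d : G.Dart, (g d.fst - c) ^ 2 := by
    rw [Finset.mul_sum, Finset.mul_sum, ← Finset.sum_add_distrib]
    refine Finset.sum_le_sum fun d _ => ?_
    have : 2 * (m : ℝ) * (g d.fst - c) ^ 2 = ∑ _i : Fin m, 2 * (g d.fst - c) ^ 2 := by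
      simp; ring
    rw [this, Finset.mul_sum, ← Finset.sum_add_distrib]
    refine Finset.sum_le_sum fun i _ => ?_
    have := sq_nonneg ((f (Sum.inr (d, i)) - f (Sum.inl d.fst)) - (g d.fst - c))
    simp only [hg] at this ⊢
    nlinarith
  have htot : ∑ x, (f x) ^ 2 ≤ (1 + 6 * m) * ((2 * m + 1) / ε * E) +
      4 * m * (2 * m + 1) * E := by
    refine (sum_sq_le_sum_sq_sub f hf c).trans ?_
    rw [Fintype.sum_sum_type, Fintype.sum_prod_type]
    have h1 : 2 * (m : ℝ) * ∑ d : G.Dart, (g d.fst - c) ^ 2 ≤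
        2 * m * (3 * ∑ v, (g v - c) ^ 2) := by gcongr
    have h2 : (1 + 6 * (m : ℝ)) * ∑ v, (g v - c) ^ 2 ≤ (1 + 6 * m) * ((2 * m + 1) / ε * E) := by
      gcongr
    simp only [hg] at *
    linarith
  refine htot.trans ?_
  have h3 : (1 + 6 * (m : ℝ)) * (2 * m + 1) ≤ 21 * m ^ 2 := by nlinarith
  have h4 : 4 * (m : ℝ) * (2 * m + 1) ≤ 12 * m ^ 2 := by nlinarith
  have h5 := mul_le_mul_of_nonneg_right h3 (div_nonneg hE0 hε.le)
  have h6 := mul_le_mul_of_nonneg_right h4 hE0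
  calc _ = (1 + 6 * (m : ℝ)) * (2 * m + 1) * (E / ε) + 4 * m * (2 * m + 1) * E := by ring
    _ ≤ 21 * m ^ 2 * (E / ε) + 12 * m ^ 2 * E := add_le_add h5 h6
    _ = _ := by ring

end SimpleGraph

namespace SimpleGraph

variable {V : Type} {G : SimpleGraph V} {m : ℕ}

open scoped Classical in
/-- The antisymmetric weight that is `1` on the dart `d₀` and `-1` on its reversal. -/
def dartSign (d₀ d : G.Dart) : ℝ :=
  (if d = d₀ then 1 else 0) - (if d = d₀.symm then 1 else 0)

/-- A tent on each half of the path replacing the edge of `d₀`, with opposite signs. -/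
def tentPair (m : ℕ) (d₀ : G.Dart) : V ⊕ G.Dart × Fin m → ℝ :=
  Sum.elim (fun _ => 0) fun p => dartSign d₀ p.1 * ((min (p.2 : ℤ) (m - 1 - p.2) : ℤ) : ℝ)

lemma dartSign_self (d₀ : G.Dart) : dartSign d₀ d₀ = 1 := by
  simp [dartSign, d₀.symm_ne.symm]

open scoped Classical in
lemma dartSign_symm (d₀ d : G.Dart) : dartSign d₀ d.symm = -dartSign d₀ d := by
  have h1 : d.symm = d₀.symm ↔ d = d₀ := Dart.symm_involutive.injective.eq_iff
  have h2 : d.symm = d₀ ↔ d = d₀.symm := by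
    rw [← Dart.symm_involutive.injective.eq_iff, Dart.symm_symm]
  simp only [dartSign, if_congr h1 rfl rfl, if_congr h2 rfl rfl]
  ring

open scoped Classical in
lemma sum_dartSign [Fintype V] (d₀ : G.Dart) : ∑ d, dartSign d₀ d = 0 := by
  simp [dartSign]

open scoped Classical in
lemma sum_dartSign_sq [Fintype V] (d₀ : G.Dart) : ∑ d, dartSign d₀ d ^ 2 ≤ 2 := by
  have : ∀ d, dartSign d₀ d ^ 2 ≤ (if d = d₀ then 1 else 0) + (if d = d₀.symm then 1 else 0) := by
    intro d
    unfold dartSign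
    split_ifs <;> norm_num
  refine (Finset.sum_le_sum fun d _ => this d).trans ?_
  rw [Finset.sum_add_distrib]
  simp
  norm_num

open scoped Classical in
lemma sum_tentPair [Fintype V] (d₀ : G.Dart) : ∑ x, tentPair m d₀ x = 0 := by
  rw [Fintype.sum_sum_type, Fintype.sum_prod_type]
  simp only [tentPair, Sum.elim_inl, Sum.elim_inr, Finset.sum_const_zero, zero_add]
  simp_rw [← Finset.mul_sum, ← Finset.sum_mul, sum_dartSign, zero_mul]

lemma sq_tentPair_sub_le (d₀ d : G.Dart) {j : ℕ} (hj : j < 2 * m + 1) :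
    (tentPair m d₀ (G.pathPoint m d j) - tentPair m d₀ (G.pathPoint m d (j + 1))) ^ 2 ≤
      dartSign d₀ d ^ 2 := by
  have key : ∀ t : ℤ, -1 ≤ t → t ≤ 1 → (dartSign d₀ d * t) ^ 2 ≤ dartSign d₀ d ^ 2 := by
    intro t ht ht'
    have : (t : ℝ) ^ 2 ≤ 1 := by
      exact_mod_cast (sq_le_one_iff_abs_le_one t).2 (abs_le.2 ⟨ht, ht'⟩)
    rw [mul_pow]
    exact mul_le_of_le_one_right (sq_nonneg _) this
  rcases pathPoint_cases (m := m) d (j := j) (by omega)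
    with ⟨h1, e1⟩ | ⟨i1, h1, e1⟩ | ⟨i1, h1, e1⟩ | ⟨h1, e1⟩ <;>
  rcases pathPoint_cases (m := m) d (j := j + 1) (by omega)
    with ⟨h3, e3⟩ | ⟨i3, h3, e3⟩ | ⟨i3, h3, e3⟩ | ⟨h3, e3⟩ <;>
  first
  | omega
  | (rw [e1, e3]
     simp only [tentPair, Sum.elim_inl, Sum.elim_inr, dartSign_symm]
     first
     | (refine (le_of_eq ?_).trans (key (min (i1 : ℤ) (m - 1 - i1) - min (i3 : ℤ) (m - 1 - i3))
          (by omega) (by omega))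
        push_cast
        ring1)
     | (refine (le_of_eq ?_).trans (key (min (i1 : ℤ) (m - 1 - i1) + min (i3 : ℤ) (m - 1 - i3))
          (by omega) (by omega))
        push_cast
        ring1)
     | (refine (le_of_eq ?_).trans (key (-min (i3 : ℤ) (m - 1 - i3))
          (by omega) (by omega))
        push_cast
        ring1)
     | (refine (le_of_eq ?_).trans (key (-min (i1 : ℤ) (m - 1 - i1))
          (by omega) (by omega))
        push_cast
        ring1)
     | (refine (le_of_eq ?_).trans (key 0
          (by omega) (by omega))
        push_cast
        ring1))

open scoped Classical in
lemma dirichletEnergy_tentPair_le [Fintype V] (hm : 0 < m) (d₀ : G.Dart) :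
    dirichletEnergy (G.subdivide m) (tentPair m d₀) ≤ 2 * m + 1 := by
  rw [dirichletEnergy_subdivide hm]
  have : ∑ d : G.Dart, ∑ j ∈ Finset.range (2 * m + 1),
      (tentPair m d₀ (G.pathPoint m d j) - tentPair m d₀ (G.pathPoint m d (j + 1))) ^ 2 ≤
      ∑ d : G.Dart, (2 * m + 1) * dartSign d₀ d ^ 2 := by
    refine Finset.sum_le_sum fun d _ => ?_
    have := Finset.sum_le_card_nsmul (Finset.range (2 * m + 1)) _ _
      fun j hj => sq_tentPair_sub_le (m := m) d₀ d (Finset.mem_range.1 hj)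
    simpa using this
  rw [← Finset.mul_sum] at this
  have h2 := mul_le_mul_of_nonneg_left (sum_dartSign_sq d₀) (by positivity : (0 : ℝ) ≤ 2 * m + 1)
  linarith

open scoped Classical in
lemma le_sum_sq_tentPair [Fintype V] (k : ℕ) (d₀ : G.Dart) :
    2 * (k : ℝ) ^ 3 ≤ ∑ x, tentPair (4 * k) d₀ x ^ 2 := by
  rw [Fintype.sum_sum_type, Fintype.sum_prod_type]
  simp only [tentPair, Sum.elim_inl, Sum.elim_inr]
  have h1 : ∑ i : Fin (4 * k), (dartSign d₀ d₀ *
      ((min (i : ℤ) ((4 * k : ℕ) - 1 - i) : ℤ) : ℝ)) ^ 2 ≤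
      ∑ d : G.Dart, ∑ i : Fin (4 * k), (dartSign d₀ d *
        ((min (i : ℤ) ((4 * k : ℕ) - 1 - i) : ℤ) : ℝ)) ^ 2 :=
    Finset.single_le_sum (f := fun d : G.Dart => ∑ i : Fin (4 * k), (dartSign d₀ d *
        ((min (i : ℤ) ((4 * k : ℕ) - 1 - i) : ℤ) : ℝ)) ^ 2)
      (fun d _ => Finset.sum_nonneg fun i _ => sq_nonneg _) (Finset.mem_univ d₀)
  rw [dartSign_self] at h1
  simp only [one_mul] at h1
  rw [Fin.sum_univ_eq_sum_range
    (fun i : ℕ => (((min (i : ℤ) ((4 * k : ℕ) - 1 - i) : ℤ) : ℝ)) ^ 2)] at h1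
  have h2 : 2 * (k : ℝ) ^ 3 ≤ ∑ i ∈ Finset.range (4 * k),
      (((min (i : ℤ) ((4 * k : ℕ) - 1 - i) : ℤ) : ℝ)) ^ 2 := by
    have hsub : Finset.Ico k (3 * k) ⊆ Finset.range (4 * k) := by
      intro i hi
      simp only [Finset.mem_Ico, Finset.mem_range] at hi ⊢
      omega
    refine le_trans ?_ (Finset.sum_le_sum_of_subset_of_nonneg hsub fun _ _ _ => sq_nonneg _)
    have := Finset.card_nsmul_le_sum (Finset.Ico k (3 * k))
      (fun i : ℕ => (((min (i : ℤ) ((4 * k : ℕ) - 1 - i) : ℤ) : ℝ)) ^ 2) ((k : ℝ) ^ 2) (by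
        intro i hi
        simp only [Finset.mem_Ico] at hi
        have : (k : ℤ) ≤ min (i : ℤ) ((4 * k : ℕ) - 1 - i) := by omega
        have : (k : ℝ) ≤ ((min (i : ℤ) ((4 * k : ℕ) - 1 - i) : ℤ) : ℝ) := by exact_mod_cast this
        gcongr)
    refine le_trans (le_of_eq ?_) this
    rw [Nat.card_Ico, nsmul_eq_mul, show 3 * k - k = 2 * k by omega]
    push_cast
    ring
  simpa using h2.trans h1

open scoped Classical in
lemma tentPair_ne_zero [Fintype V] {k : ℕ} (hk : 0 < k) (d₀ : G.Dart) :
    tentPair (4 * k) d₀ ≠ 0 := by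
  intro h
  have := le_sum_sq_tentPair k d₀
  rw [h] at this
  simp at this
  have : (0 : ℝ) < k := by exact_mod_cast hk
  have : (0 : ℝ) < 2 * k ^ 3 := by positivity
  linarith

open scoped Classical in
lemma spectralGap_subdivide_le [Fintype V] {k : ℕ} (hk : 0 < k) (d₀ : G.Dart) :
    spectralGap (G.subdivide (4 * k)) ≤ 5 / (k : ℝ) ^ 2 := by
  have hk1 : (1 : ℝ) ≤ k := by exact_mod_cast hk
  refine (spectralGap_le _ (tentPair_ne_zero hk d₀) (sum_tentPair d₀)).trans ?_
  rw [rayleighQuot_eq, div_le_div_iff₀ (sum_sq_pos (tentPair_ne_zero hk d₀)) (by positivity)]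
  have h1 := dirichletEnergy_tentPair_le (m := 4 * k) (by omega) d₀
  have h2 := le_sum_sq_tentPair k d₀
  push_cast at h1
  have h3 : dirichletEnergy (G.subdivide (4 * k)) (tentPair (4 * k) d₀) ≤ 9 * k := by linarith
  calc _ ≤ 9 * (k : ℝ) * k ^ 2 := by gcongr
    _ ≤ 5 * (2 * (k : ℝ) ^ 3) := by nlinarith [pow_pos (by linarith : (0 : ℝ) < k) 3]
    _ ≤ _ := by gcongr

open scoped Classical in
lemma le_spectralGap_subdivide [Fintype V] [Nonempty V] {ε : ℝ} (hε : 0 < ε)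
    (hG : ε ≤ spectralGap G) (hdeg : ∀ v, (G.neighborSet v).ncard ≤ 3) {k : ℕ} (hk : 0 < k)
    (d₀ : G.Dart) :
    ((21 / ε + 12) * 16)⁻¹ / (k : ℝ) ^ 2 ≤ spectralGap (G.subdivide (4 * k)) := by
  refine le_spectralGap ⟨_, tentPair_ne_zero hk d₀, sum_tentPair d₀⟩ fun f hf => ?_
  have h := sum_sq_le_dirichletEnergy_subdivide hε hG hdeg (by omega : 0 < 4 * k) f hf
  have hk0 : (0 : ℝ) < k := by exact_mod_cast hk
  rw [div_mul_eq_mul_div, div_le_iff₀ (by positivity), inv_mul_le_iff₀ (by positivity)]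
  refine h.trans (le_of_eq ?_)
  push_cast
  ring

end SimpleGraph

open scoped Classical in
lemma two_mul_ncard_edgeSet {V : Type} [Fintype V] (G : SimpleGraph V) :
    2 * (G.edgeSet.ncard : ℝ) = ∑ x : V, ∑ y : V, if G.Adj x y then 1 else 0 := by
  rw [sum_adj_eq_sum_dart G fun _ _ => 1, Finset.sum_const, nsmul_eq_mul, mul_one,
    Finset.card_univ, SimpleGraph.dart_card_eq_twice_card_edges, ← SimpleGraph.coe_edgeFinset,
    Set.ncard_coe_finset]
  push_cast
  rfl

open scoped Classical in
lemma card_dart_eq {V : Type} [Fintype V] (G : SimpleGraph V) :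
    (Fintype.card G.Dart : ℝ) = ∑ x : V, ((G.neighborSet x).ncard : ℝ) := by
  simpa using sum_dart_fst G fun _ => 1

namespace SimpleGraph

variable {V : Type} {G : SimpleGraph V} {m : ℕ}

open scoped Classical in
lemma two_mul_ncard_edgeSet_subdivide [Fintype V] (hm : 0 < m) :
    2 * ((G.subdivide m).edgeSet.ncard : ℝ) = (2 * m + 1) * Fintype.card G.Dart := by
  rw [two_mul_ncard_edgeSet, sum_subdivide_adj hm fun _ _ => 1]
  simp
  ring

lemma ncard_neighborSet_subdivide_inr_le (e : G.Dart) (i : Fin m) :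
    ((G.subdivide m).neighborSet (Sum.inr (e, i))).ncard ≤ 2 := by
  have hsub : (G.subdivide m).neighborSet (Sum.inr (e, i)) ⊆
      {G.pathPoint m e (i + 2), G.pathPoint m e i} := by
    rintro y ⟨-, d, j, hj, hx, rfl⟩
    rcases pathPoint_cases (m := m) d (j := j) (by omega)
      with ⟨h1, e1⟩ | ⟨i1, h1, e1⟩ | ⟨i1, h1, e1⟩ | ⟨h1, e1⟩ <;> rw [e1] at hx
    · cases hx
    · simp only [Sum.inr.injEq, Prod.mk.injEq] at hx
      obtain ⟨rfl, rfl⟩ := hx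
      left
      rw [h1]
    · simp only [Sum.inr.injEq, Prod.mk.injEq] at hx
      obtain ⟨rfl, rfl⟩ := hx
      right
      rw [← pathPoint_symm d (by omega : j + 1 ≤ 2 * m + 1)]
      show _ = _
      congr 1
      omega
    · cases hx
  refine (Set.ncard_le_ncard hsub).trans ((Set.ncard_insert_le _ _).trans ?_)
  rw [Set.ncard_singleton]

lemma ncard_neighborSet_subdivide_inl_le [Finite V] (v : V) :
    ((G.subdivide m).neighborSet (Sum.inl v)).ncard ≤ (G.neighborSet v).ncard := by
  classical
  have hsub : (G.subdivide m).neighborSet (Sum.inl v) ⊆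
      (fun w => if h : G.Adj v w then G.pathPoint m ⟨(v, w), h⟩ 1 else Sum.inl v) ''
        G.neighborSet v := by
    rintro y ⟨-, d, j, hj, hx, rfl⟩
    rcases pathPoint_cases (m := m) d (j := j) (by omega)
      with ⟨h1, e1⟩ | ⟨i1, h1, e1⟩ | ⟨i1, h1, e1⟩ | ⟨h1, e1⟩
    · rw [e1] at hx
      simp only [Sum.inl.injEq] at hx
      subst hx
      refine ⟨d.snd, d.adj, ?_⟩
      simp [h1, d.adj]
    · rw [e1] at hx
      cases hx
    · rw [e1] at hx
      cases hx
    · omega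
  exact (Set.ncard_le_ncard hsub (Set.toFinite _)).trans (Set.ncard_image_le (Set.toFinite _))

lemma exists_walk_pathPoint (hm : 0 < m) (d : G.Dart) {j : ℕ} (hj : j ≤ 2 * m + 1) :
    ∃ w : (G.subdivide m).Walk (Sum.inl d.fst) (G.pathPoint m d j), w.length = j := by
  rw [← pathPoint_zero d]
  induction j with
  | zero => exact ⟨Walk.nil, rfl⟩
  | succ j ih =>
    obtain ⟨w, hw⟩ := ih (by omega)
    exact ⟨w.concat (subdivide_adj_pathPoint hm d (by omega)), by simp [hw]⟩

lemma exists_walk_inl (hm : 0 < m) {a b : V} (p : G.Walk a b) :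
    ∃ w : (G.subdivide m).Walk (Sum.inl a) (Sum.inl b), w.length = (2 * m + 1) * p.length := by
  induction p with
  | nil => exact ⟨Walk.nil, rfl⟩
  | cons h p ih =>
    obtain ⟨w, hw⟩ := ih
    obtain ⟨w', hw'⟩ : ∃ w' : (G.subdivide m).Walk (Sum.inl _) (Sum.inl _),
        w'.length = 2 * m + 1 := by
      have := exists_walk_pathPoint hm ⟨(_, _), h⟩ (le_refl (2 * m + 1))
      rwa [pathPoint_end] at this
    exact ⟨w'.append w, by simp [hw, hw']; ring⟩

lemma exists_inl_walk (hm : 0 < m) (x : V ⊕ G.Dart × Fin m) :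
    ∃ v, ∃ w : (G.subdivide m).Walk (Sum.inl v) x, w.length ≤ m := by
  rcases x with v | ⟨d, i⟩
  · exact ⟨v, Walk.nil, by simp⟩
  · have := exists_walk_pathPoint hm d (by omega : (i : ℕ) + 1 ≤ 2 * m + 1)
    rw [pathPoint_succ] at this
    obtain ⟨w, hw⟩ := this
    exact ⟨d.fst, w, by omega⟩

lemma connected_subdivide (hm : 0 < m) (hG : G.Connected) : (G.subdivide m).Connected := by
  obtain ⟨a⟩ := hG.nonempty
  refine connected_iff_exists_forall_reachable _ |>.2 ⟨Sum.inl a, fun x => ?_⟩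
  obtain ⟨v, w, -⟩ := exists_inl_walk hm x
  obtain ⟨p⟩ := hG.preconnected a v
  obtain ⟨w', -⟩ := exists_walk_inl hm p
  exact ⟨w'.append w⟩

lemma dist_inl_le (hm : 0 < m) (hG : G.Connected) (a b : V) :
    (G.subdivide m).dist (Sum.inl a) (Sum.inl b) ≤ (2 * m + 1) * G.dist a b := by
  obtain ⟨p, hp⟩ := hG.exists_walk_length_eq_dist a b
  obtain ⟨w, hw⟩ := exists_walk_inl hm p
  rw [← hp, ← hw]
  exact dist_le w

/-- The distance from `Sum.inl a` in the subdivided graph, see `dist_inl_eq`. -/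
def subdivideDist (G : SimpleGraph V) (m : ℕ) (a : V) : V ⊕ G.Dart × Fin m → ℕ :=
  Sum.elim (fun v => (2 * m + 1) * G.dist a v) fun p =>
    min ((2 * m + 1) * G.dist a p.1.fst + (p.2 + 1))
      ((2 * m + 1) * G.dist a p.1.snd + (2 * m - p.2))

lemma subdivideDist_pathPoint (hG : G.Connected) (a : V) (d : G.Dart) {j : ℕ}
    (hj : j ≤ 2 * m + 1) :
    G.subdivideDist m a (G.pathPoint m d j) =
      min ((2 * m + 1) * G.dist a d.fst + j) ((2 * m + 1) * G.dist a d.snd + (2 * m + 1 - j)) := by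
  have h1 : G.dist a d.fst ≤ G.dist a d.snd + 1 := by
    simpa [dist_eq_one_iff_adj.2 d.adj.symm] using hG.dist_triangle (u := a) (v := d.snd) (w := d.fst)
  have h2 : G.dist a d.snd ≤ G.dist a d.fst + 1 := by
    simpa [dist_eq_one_iff_adj.2 d.adj] using hG.dist_triangle (u := a) (v := d.fst) (w := d.snd)
  replace h1 := Nat.mul_le_mul_left (2 * m + 1) h1
  replace h2 := Nat.mul_le_mul_left (2 * m + 1) h2
  rcases pathPoint_cases (m := m) d hj
    with ⟨h3, e⟩ | ⟨i, h3, e⟩ | ⟨i, h3, e⟩ | ⟨h3, e⟩ <;> rw [e] <;>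
    simp only [subdivideDist, Sum.elim_inl, Sum.elim_inr, Dart.symm_toProd, Prod.fst_swap,
      Prod.snd_swap] <;> rw [mul_add] at h1 h2 <;> omega

lemma subdivideDist_le_add_length (hG : G.Connected) (a : V) {x y : V ⊕ G.Dart × Fin m}
    (w : (G.subdivide m).Walk x y) :
    G.subdivideDist m a y ≤ G.subdivideDist m a x + w.length := by
  induction w with
  | nil => simp
  | cons h p ih =>
    rw [Walk.length_cons]
    obtain ⟨-, d, j, hj, rfl, rfl⟩ := h
    rw [subdivideDist_pathPoint hG a d (by omega)] at ih ⊢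
    omega

lemma dist_inl_eq (hm : 0 < m) (hG : G.Connected) (a : V) (x : V ⊕ G.Dart × Fin m) :
    (G.subdivide m).dist (Sum.inl a) x = G.subdivideDist m a x := by
  have hY := connected_subdivide hm hG
  refine le_antisymm ?_ ?_
  · have key : ∀ d : G.Dart, ∀ j ≤ 2 * m + 1, (G.subdivide m).dist (Sum.inl a) (G.pathPoint m d j)
        ≤ (2 * m + 1) * G.dist a d.fst + j := by
      intro d j hj
      obtain ⟨w, hw⟩ := exists_walk_pathPoint hm d hj
      refine (hY.dist_triangle (v := Sum.inl d.fst)).trans (add_le_add (dist_inl_le hm hG _ _) ?_)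
      exact (dist_le w).trans hw.le
    rcases x with v | ⟨d, i⟩
    · exact dist_inl_le hm hG a v
    · refine le_min ?_ ?_
      · rw [← pathPoint_succ]
        exact key d _ (by omega)
      · have := key d.symm (2 * m + 1 - (i + 1)) (by omega)
        rw [pathPoint_symm d (by omega), pathPoint_succ] at this
        refine this.trans (le_of_eq ?_)
        simp only [Dart.symm_toProd, Prod.fst_swap]
        omega
  · obtain ⟨w, hw⟩ := hY.exists_walk_length_eq_dist (Sum.inl a) x
    have := subdivideDist_le_add_length hG a w
    rw [hw] at this
    simpa [subdivideDist] using this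

lemma diam_subdivide_le [Finite V] (hm : 0 < m) (hG : G.Connected) :
    (G.subdivide m).diam ≤ (2 * m + 1) * (G.diam + 1) := by
  have hY := connected_subdivide hm hG
  have := hG.nonempty
  obtain ⟨x, y, hxy⟩ := (G.subdivide m).exists_dist_eq_diam
  rw [← hxy]
  obtain ⟨u, p, hp⟩ := exists_inl_walk hm x
  obtain ⟨v, q, hq⟩ := exists_inl_walk hm y
  have h1 := dist_le p
  have h2 := dist_le q
  have h3 := dist_inl_le hm hG u v
  have h4 := Nat.mul_le_mul_left (2 * m + 1)
    (dist_le_diam (connected_iff_ediam_ne_top.1 hG) (u := u) (v := v))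
  have h5 := hY.dist_triangle (u := x) (v := Sum.inl u) (w := y)
  have h6 := hY.dist_triangle (u := Sum.inl u) (v := Sum.inl v) (w := y)
  rw [dist_comm] at h1
  rw [mul_add]
  omega

lemma le_diam_subdivide [Finite V] (hm : 0 < m) (hG : G.Connected) :
    (2 * m + 1) * G.diam ≤ (G.subdivide m).diam := by
  have hY := connected_subdivide hm hG
  have := hG.nonempty
  have : Finite G.Dart := Finite.of_injective _ Dart.toProd_injective
  obtain ⟨x, y, hxy⟩ := G.exists_dist_eq_diam
  have := dist_le_diam (connected_iff_ediam_ne_top.1 hY) (u := Sum.inl x) (v := Sum.inl y)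
  rwa [dist_inl_eq hm hG, subdivideDist, Sum.elim_inl, hxy] at this

open scoped Classical in
lemma ncard_sphere_subdivide_le [Fintype V] (hm : 0 < m) (hG : G.Connected) (a : V) (k : ℕ) :
    {x | (G.subdivide m).dist (Sum.inl a) x = k}.ncard ≤
      Fintype.card V + 2 * Fintype.card G.Dart := by
  let φ : V ⊕ G.Dart × Fin m → V ⊕ G.Dart × Bool :=
    Sum.map id fun p => (p.1, decide (k = (2 * m + 1) * G.dist a p.1.fst + (p.2 + 1)))
  have hφ : Set.InjOn φ {x | (G.subdivide m).dist (Sum.inl a) x = k} := by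
    rintro (v | ⟨d, i⟩) hx (v' | ⟨d', i'⟩) hy hxy
    · simpa [φ] using hxy
    · simp [φ] at hxy
    · simp [φ] at hxy
    · simp only [Set.mem_ofPred_eq, dist_inl_eq hm hG, subdivideDist, Sum.elim_inr] at hx hy
      simp only [φ, Sum.map_inr, Sum.inr.injEq, Prod.mk.injEq, decide_eq_decide] at hxy
      obtain ⟨rfl, h⟩ := hxy
      simp only [Sum.inr.injEq, Prod.mk.injEq, true_and]
      ext
      omega
  have := Set.ncard_le_ncard_of_injOn φ (t := Set.univ) (fun _ _ => Set.mem_univ _) hφ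
  refine this.trans (le_of_eq ?_)
  rw [Set.ncard_univ, Nat.card_eq_fintype_card]
  simp [mul_comm]

end SimpleGraph

namespace SimpleGraph

variable {V : Type} [Fintype V] {G : SimpleGraph V}

open scoped Classical in
/-- The closed ball of radius `r` in the graph metric. -/
def distBall (G : SimpleGraph V) (v : V) (r : ℕ) : Finset V :=
  Finset.univ.filter fun x => G.dist v x ≤ r

lemma mem_distBall {v x : V} {r : ℕ} : x ∈ G.distBall v r ↔ G.dist v x ≤ r := by
  simp [distBall]

lemma distBall_subset_succ (v : V) (r : ℕ) : G.distBall v r ⊆ G.distBall v (r + 1) := by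
  intro x
  simp only [mem_distBall]
  omega

lemma mem_distBall_succ_of_adj (hG : G.Connected) {v x y : V} {r : ℕ} (h : G.Adj x y)
    (hx : x ∈ G.distBall v r) : y ∈ G.distBall v (r + 1) := by
  rw [mem_distBall] at hx ⊢
  have := hG.dist_triangle (u := v) (v := x) (w := y)
  rw [dist_eq_one_iff_adj.2 h] at this
  omega

lemma exists_adj_of_mem_distBall_succ (hG : G.Connected) {v y : V} {r : ℕ}
    (hy : y ∈ G.distBall v (r + 1)) (hy' : y ∉ G.distBall v r) :
    ∃ x ∈ G.distBall v r, G.Adj x y := by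
  rw [mem_distBall] at hy hy'
  obtain ⟨w, hw⟩ := hG.exists_walk_length_eq_dist y v
  cases w with
  | nil => simp at hy'
  | @cons _ x _ h p =>
    refine ⟨x, ?_, h.symm⟩
    rw [mem_distBall, dist_comm]
    rw [dist_comm, Walk.length_cons] at hw
    have := dist_le p
    omega

lemma card_distBall_succ_le (hG : G.Connected) (hdeg : ∀ v, (G.neighborSet v).ncard ≤ 3) (v : V)
    (r : ℕ) : (G.distBall v (r + 1)).card ≤ 4 * (G.distBall v r).card := by
  classical
  have hsub : G.distBall v (r + 1) ⊆
      (G.distBall v r).biUnion fun x => insert x (G.neighborFinset x) := by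
    intro y hy
    rw [Finset.mem_biUnion]
    by_cases hy' : y ∈ G.distBall v r
    · exact ⟨y, hy', Finset.mem_insert_self _ _⟩
    · obtain ⟨x, hx, h⟩ := exists_adj_of_mem_distBall_succ hG hy hy'
      exact ⟨x, hx, Finset.mem_insert_of_mem (by simpa using h)⟩
  refine (Finset.card_le_card hsub).trans ?_
  rw [mul_comm]
  refine Finset.card_biUnion_le_card_mul _ _ _ fun x _ => (Finset.card_insert_le _ _).trans ?_
  have := hdeg x
  rw [← coe_neighborFinset, Set.ncard_coe_finset] at this
  omega

lemma card_le_four_pow_diam (hG : G.Connected) (hdeg : ∀ v, (G.neighborSet v).ncard ≤ 3) :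
    Fintype.card V ≤ 4 ^ G.diam := by
  have := hG.nonempty
  obtain ⟨v⟩ := hG.nonempty
  have h : ∀ r, (G.distBall v r).card ≤ 4 ^ r := by
    intro r
    induction r with
    | zero =>
      have : G.distBall v 0 = {v} := by
        ext x
        simp [mem_distBall, hG.dist_eq_zero_iff, eq_comm]
      simp [this]
    | succ r ih =>
      have := card_distBall_succ_le hG hdeg v r
      rw [pow_succ]
      omega
  have : G.distBall v G.diam = Finset.univ := by
    ext x
    simp [mem_distBall, dist_le_diam (connected_iff_ediam_ne_top.1 hG)]
  simpa [this] using h G.diam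

open scoped Classical in
lemma dirichletEnergy_indicator_distBall_le (hG : G.Connected)
    (hdeg : ∀ v, (G.neighborSet v).ncard ≤ 3) (v : V) (r : ℕ) :
    dirichletEnergy G (fun x => if x ∈ G.distBall v r then 1 else 0) ≤
      3 * ((G.distBall v (r + 1)).card - (G.distBall v r).card : ℝ) := by
  set S := G.distBall v r with hS
  set T := G.distBall v (r + 1) with hT
  have hST : S ⊆ T := distBall_subset_succ v r
  let b : V → ℝ := fun x => if x ∈ T \ S then 1 else 0
  have hb : ∑ x, b x = (T.card : ℝ) - S.card := by
    have : (T \ S).card + S.card = T.card := Finset.card_sdiff_add_card_eq_card hST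
    simp only [b, Finset.sum_ite_mem, Finset.univ_inter, Finset.sum_const, nsmul_eq_mul, mul_one]
    rw [← this]
    push_cast
    ring
  have hfst : ∑ d : G.Dart, b d.fst ≤ 3 * ∑ x, b x := by
    rw [sum_dart_fst, Finset.mul_sum]
    refine Finset.sum_le_sum fun x _ => mul_le_mul_of_nonneg_right (by exact_mod_cast hdeg x) ?_
    simp only [b]
    split_ifs <;> norm_num
  have hsnd : ∑ d : G.Dart, b d.snd = ∑ d : G.Dart, b d.fst :=
    Fintype.sum_equiv (Dart.symm_involutive.toPerm _) _ _ fun d => rfl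
  have hle : ∀ d : G.Dart, ((if d.fst ∈ S then (1 : ℝ) else 0) - (if d.snd ∈ S then 1 else 0)) ^ 2
      ≤ b d.fst + b d.snd := by
    intro d
    have h1 : d.fst ∈ S → d.snd ∈ T := mem_distBall_succ_of_adj hG d.adj
    have h2 : d.snd ∈ S → d.fst ∈ T := mem_distBall_succ_of_adj hG d.adj.symm
    by_cases h3 : d.fst ∈ S <;> by_cases h4 : d.snd ∈ S
    · simp [b, h3, h4]
    · simp [b, h3, h4, h1 h3]
    · simp [b, h3, h4, h2 h4]
    · simp only [b, h3, h4, if_false]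
      split_ifs <;> norm_num
  rw [dirichletEnergy_eq_sum_dart]
  have := Finset.sum_le_sum fun (d : G.Dart) (_ : d ∈ Finset.univ) => hle d
  rw [Finset.sum_add_distrib, hsnd] at this
  rw [← hb]
  linarith

lemma mul_card_distBall_le {ε : ℝ} (hε : ε ≤ spectralGap G) (hG : G.Connected)
    (hdeg : ∀ v, (G.neighborSet v).ncard ≤ 3) (v : V) (r : ℕ) :
    ε * ((G.distBall v r).card * (Fintype.card V - (G.distBall v r).card)) ≤
      3 * Fintype.card V * ((G.distBall v (r + 1)).card - (G.distBall v r).card : ℝ) := by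
  classical
  have hN : (0 : ℝ) < Fintype.card V := by
    have := hG.nonempty
    exact_mod_cast Fintype.card_pos
  have hE := dirichletEnergy_indicator_distBall_le hG hdeg v r
  set S := G.distBall v r
  set N : ℝ := (Fintype.card V : ℝ) with hNdef
  let u : V → ℝ := fun x => if x ∈ S then 1 else 0
  have hu : ∑ x, u x = S.card := by simp [u]
  have hu2 : ∑ x, u x ^ 2 = S.card := by simp [u]
  have hmean : ∑ x, (u x - S.card / N) = 0 := by
    rw [Finset.sum_sub_distrib, hu, Finset.sum_const, Finset.card_univ, nsmul_eq_mul, ← hNdef]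
    field_simp
    ring
  have hsq : ∑ x, (u x - S.card / N) ^ 2 = S.card * (N - S.card) / N := by
    have : ∀ x, (u x - S.card / N) ^ 2 = u x ^ 2 - 2 * (S.card / N) * u x + (S.card / N) ^ 2 :=
      fun x => by ring
    simp_rw [this]
    rw [Finset.sum_add_distrib, Finset.sum_sub_distrib, ← Finset.mul_sum, hu, hu2,
      Finset.sum_const, Finset.card_univ, nsmul_eq_mul, ← hNdef]
    field_simp
    ring
  have h := mul_sum_sq_le_dirichletEnergy hε _ hmean
  have htrans : dirichletEnergy G (fun x => u x - S.card / N) = dirichletEnergy G u := by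
    simp [dirichletEnergy]
  rw [htrans, hsq] at h
  have h' := h.trans hE
  rw [← mul_div_assoc, div_le_iff₀ hN] at h'
  linarith

lemma pow_le_card_distBall {ε : ℝ} (hε0 : 0 < ε) (hε : ε ≤ spectralGap G) (hG : G.Connected)
    (hdeg : ∀ v, (G.neighborSet v).ncard ≤ 3) (v : V) (r : ℕ)
    (hr : 2 * (G.distBall v r).card ≤ Fintype.card V) :
    (1 + ε / 6) ^ r ≤ (G.distBall v r).card := by
  have hN : (0 : ℝ) < Fintype.card V := by
    have := hG.nonempty
    exact_mod_cast Fintype.card_pos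
  induction r with
  | zero =>
    have : 0 < (G.distBall v 0).card := Finset.card_pos.2 ⟨v, by simp [mem_distBall]⟩
    simpa using this
  | succ r ih =>
    have hmono := Finset.card_le_card (distBall_subset_succ (G := G) v r)
    have h1 := ih (by omega)
    have h2 := mul_card_distBall_le hε hG hdeg v r
    have h3 : 2 * ((G.distBall v r).card : ℝ) ≤ Fintype.card V := by
      exact_mod_cast (by omega : 2 * (G.distBall v r).card ≤ Fintype.card V)
    set s : ℝ := ((G.distBall v r).card : ℝ)
    set t : ℝ := ((G.distBall v (r + 1)).card : ℝ)
    set N : ℝ := (Fintype.card V : ℝ)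
    have hs : 0 ≤ s := Nat.cast_nonneg _
    have h4 : ε * (s * (N / 2)) ≤ 3 * N * (t - s) := by
      refine le_trans ?_ h2
      gcongr
      linarith
    have h5 : ε * s / 6 ≤ t - s := by
      refine le_of_mul_le_mul_left ?_ hN
      linarith
    calc (1 + ε / 6) ^ (r + 1) = (1 + ε / 6) ^ r * (1 + ε / 6) := pow_succ _ _
      _ ≤ s * (1 + ε / 6) := by gcongr
      _ ≤ t := by linarith

lemma diam_le_of_card_lt_pow {ε : ℝ} (hε0 : 0 < ε) (hε : ε ≤ spectralGap G) (hG : G.Connected)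
    (hdeg : ∀ v, (G.neighborSet v).ncard ≤ 3) {r : ℕ}
    (hr : (Fintype.card V : ℝ) < (1 + ε / 6) ^ r) : G.diam ≤ 2 * r := by
  classical
  have hbig : ∀ v, Fintype.card V < 2 * (G.distBall v r).card := by
    intro v
    by_contra! h
    have h1 := pow_le_card_distBall hε0 hε hG hdeg v r h
    have h2 : ((G.distBall v r).card : ℝ) ≤ Fintype.card V := by
      exact_mod_cast Finset.card_le_univ _
    linarith
  have := hG.nonempty
  obtain ⟨x, y, hxy⟩ := G.exists_dist_eq_diam
  obtain ⟨z, hz⟩ : (G.distBall x r ∩ G.distBall y r).Nonempty := by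
    refine Finset.inter_nonempty_of_card_lt_card_add_card (Finset.subset_univ _)
      (Finset.subset_univ _) ?_
    have h1 := hbig x
    have h2 := hbig y
    rw [Finset.card_univ]
    omega
  rw [Finset.mem_inter, mem_distBall, mem_distBall] at hz
  have h := hG.dist_triangle (u := x) (v := z) (w := y)
  rw [dist_comm (u := z)] at h
  omega

lemma diam_le_log_card {ε : ℝ} (hε0 : 0 < ε) (hε : ε ≤ spectralGap G) (hG : G.Connected)
    (hdeg : ∀ v, (G.neighborSet v).ncard ≤ 3) :
    (G.diam : ℝ) ≤ 2 * (Real.log (Fintype.card V) / Real.log (1 + ε / 6)) + 2 := by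
  have hN : (1 : ℝ) ≤ Fintype.card V := by
    have := hG.nonempty
    exact_mod_cast Fintype.card_pos
  have hq : 0 < Real.log (1 + ε / 6) := Real.log_pos (by linarith)
  set a := Real.log (Fintype.card V) / Real.log (1 + ε / 6) with ha
  have ha0 : 0 ≤ a := div_nonneg (Real.log_nonneg hN) hq.le
  have h := diam_le_of_card_lt_pow hε0 hε hG hdeg (r := ⌊a⌋₊ + 1) (by
    rw [← Real.log_lt_log_iff (by linarith) (by positivity), Real.log_pow, ← div_lt_iff₀ hq]
    exact_mod_cast Nat.lt_floor_add_one a)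
  have h1 : (G.diam : ℝ) ≤ 2 * ((⌊a⌋₊ : ℝ) + 1) := by exact_mod_cast h
  have := Nat.floor_le ha0
  linarith

end SimpleGraph

lemma log_le_mul_of_card_le {c N n D : ℝ} (hc : 0 < c) (hn : 0 < n) (hD : 1 ≤ D)
    (hcN : c * n ≤ N) (hN : Real.log N ≤ D * Real.log 4) :
    Real.log n ≤ (Real.log 4 + |Real.log c|) * D := by
  have h1 := Real.log_le_log (by positivity) hcN
  rw [Real.log_mul hc.ne' hn.ne'] at h1
  have h2 := neg_abs_le (Real.log c)
  have h3 := mul_le_mul_of_nonneg_left hD (abs_nonneg (Real.log c))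
  linarith

lemma add_one_le_mul_log {c N n D q : ℝ} (hc : 0 < c) (hn : 2 ≤ n) (hN0 : 0 < N) (hq : 0 < q)
    (hNc : N ≤ c * n) (hD : D ≤ 2 * (Real.log N / q) + 2) :
    D + 1 ≤ (3 / Real.log 2 + 2 * (1 + |Real.log c| / Real.log 2) / q) * Real.log n := by
  have hl2 : 0 < Real.log 2 := Real.log_pos (by norm_num)
  have hln : Real.log 2 ≤ Real.log n := Real.log_le_log (by norm_num) hn
  have h1 := Real.log_le_log hN0 hNc
  rw [Real.log_mul hc.ne' (by positivity)] at h1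
  have hr : 1 ≤ Real.log n / Real.log 2 := (one_le_div hl2).2 hln
  have h2 : Real.log N ≤ (1 + |Real.log c| / Real.log 2) * Real.log n := by
    have h3 := mul_le_mul_of_nonneg_left hr (abs_nonneg (Real.log c))
    have h4 := le_abs_self (Real.log c)
    calc Real.log N ≤ Real.log n + |Real.log c| * (Real.log n / Real.log 2) := by linarith
      _ = _ := by ring
  have h5 : Real.log N / q ≤ (1 + |Real.log c| / Real.log 2) * Real.log n / q := by gcongr
  calc D + 1 ≤ 3 * (Real.log n / Real.log 2) +
        2 * ((1 + |Real.log c| / Real.log 2) * Real.log n / q) := by linarith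
    _ = _ := by ring

open SimpleGraph in
/-- The estimates for the subdivision of a single graph, with explicit conditions on `C`. -/
lemma subdivide_estimates {ε c₁ c₂ C : ℝ} (hε : 0 < ε) (hc₁ : 0 < c₁) (hc₂ : 0 < c₂)
    {V : Type} [Fintype V] (G : SimpleGraph V) {n : ℕ} (hn : 2 ≤ n) (hG : G.Connected)
    (hdeg : ∀ v, (G.neighborSet v).ncard = 2 ∨ (G.neighborSet v).ncard = 3)
    (hcard₁ : c₁ * (n : ℝ) ≤ Fintype.card V) (hcard₂ : (Fintype.card V : ℝ) ≤ c₂ * n)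
    (hgap : ε ≤ spectralGap G)
    (hC₁ : (8 * c₁)⁻¹ ≤ C) (hC₂ : 14 * c₂ ≤ C)
    (hC₃ : Real.log 4 + |Real.log c₁| ≤ C)
    (hC₄ : 9 * (3 / Real.log 2 + 2 * (1 + |Real.log c₂| / Real.log 2) / Real.log (1 + ε / 6)) ≤ C)
    (hC₅ : (21 / ε + 12) * 16 ≤ C) (hC₆ : 5 ≤ C) :
    ∃ (W : Type) (_ : Fintype W) (Y : SimpleGraph W) (p : W),
      Y.Connected ∧
      (∀ v : W, (Y.neighborSet v).ncard ≤ 3) ∧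
      (C⁻¹ * (n : ℝ) ^ 11 ≤ (Y.edgeSet.ncard : ℝ) ∧
        (Y.edgeSet.ncard : ℝ) ≤ C * (n : ℝ) ^ 11) ∧
      (C⁻¹ * (n : ℝ) ^ 10 * Real.log n ≤ (Y.diam : ℝ) ∧
        (Y.diam : ℝ) ≤ C * (n : ℝ) ^ 10 * Real.log n) ∧
      (C⁻¹ / (n : ℝ) ^ 20 ≤ spectralGap Y ∧ spectralGap Y ≤ C / (n : ℝ) ^ 20) ∧
      (∀ k : ℕ, ({v : W | Y.dist p v = k}.ncard : ℝ) ≤ C * (n : ℝ)) := by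
  classical
  have hne := hG.nonempty
  obtain ⟨a⟩ := hG.nonempty
  have hdeg3 : ∀ v, (G.neighborSet v).ncard ≤ 3 := fun v => by have := hdeg v; omega
  have hdeg2 : ∀ v, 2 ≤ (G.neighborSet v).ncard := fun v => by have := hdeg v; omega
  obtain ⟨b, hab⟩ : (G.neighborSet a).Nonempty :=
    Set.nonempty_of_ncard_ne_zero (by have := hdeg2 a; omega)
  let d₀ : G.Dart := ⟨(a, b), hab⟩
  have hn2 : (2 : ℝ) ≤ n := by exact_mod_cast hn
  have hn0 : (0 : ℝ) < n := by linarith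
  have hlog : 0 < Real.log n := Real.log_pos (by linarith)
  have hC0 : 0 < C := by linarith
  have hN0 : (0 : ℝ) < Fintype.card V := by exact_mod_cast Fintype.card_pos
  have hk : 0 < n ^ 10 := by positivity
  have hm : 0 < 4 * n ^ 10 := by positivity
  have hkR : (1 : ℝ) ≤ (n : ℝ) ^ 10 := by exact_mod_cast hk
  have hD₂ : (Fintype.card G.Dart : ℝ) ≤ 3 * Fintype.card V := by
    rw [card_dart_eq]
    have : ∀ x ∈ (Finset.univ : Finset V), ((G.neighborSet x).ncard : ℝ) ≤ 3 :=
      fun x _ => by exact_mod_cast hdeg3 x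
    simpa [mul_comm] using Finset.sum_le_card_nsmul _ _ _ this
  have hD₁ : 2 * (Fintype.card V : ℝ) ≤ Fintype.card G.Dart := by
    rw [card_dart_eq]
    have : ∀ x ∈ (Finset.univ : Finset V), (2 : ℝ) ≤ ((G.neighborSet x).ncard : ℝ) :=
      fun x _ => by exact_mod_cast hdeg2 x
    simpa [mul_comm] using Finset.card_nsmul_le_sum _ _ _ this
  have hdiam : 1 ≤ G.diam := by
    have : Nontrivial V := ⟨a, b, hab.ne⟩
    exact Nat.one_le_iff_ne_zero.2 (connected_iff_diam_ne_zero.1 hG)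
  have hlogN : Real.log (Fintype.card V) ≤ G.diam * Real.log 4 := by
    rw [← Real.log_pow]
    exact Real.log_le_log hN0 (by exact_mod_cast card_le_four_pow_diam hG hdeg3)
  have hdiam₁ := log_le_mul_of_card_le hc₁ hn0 (by exact_mod_cast hdiam) hcard₁ hlogN
  have hdiam₂ := add_one_le_mul_log hc₂ hn2 hN0 (Real.log_pos (by linarith)) hcard₂
    (diam_le_log_card hε hgap hG hdeg3)
  have hE := two_mul_ncard_edgeSet_subdivide (G := G) hm
  push_cast at hE
  refine ⟨V ⊕ G.Dart × Fin (4 * n ^ 10), inferInstance, G.subdivide (4 * n ^ 10), Sum.inl a,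
    connected_subdivide hm hG, ?_, ⟨?_, ?_⟩, ⟨?_, ?_⟩, ⟨?_, ?_⟩, ?_⟩
  · rintro (v | ⟨d, i⟩)
    · exact (ncard_neighborSet_subdivide_inl_le v).trans (hdeg3 v)
    · exact (ncard_neighborSet_subdivide_inr_le d i).trans (by norm_num)
  · have h1 : C⁻¹ ≤ 8 * c₁ := inv_le_of_inv_le₀ (by positivity) hC₁
    have h2 : 8 * (n : ℝ) ^ 10 * (2 * (c₁ * n)) ≤
        (2 * (4 * (n : ℝ) ^ 10) + 1) * Fintype.card G.Dart := by
      gcongr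
      · linarith
      · linarith
    calc C⁻¹ * (n : ℝ) ^ 11 ≤ 8 * c₁ * (n : ℝ) ^ 11 := by gcongr
      _ ≤ _ := by linarith
  · have h2 : (2 * (4 * (n : ℝ) ^ 10) + 1) * Fintype.card G.Dart ≤
        9 * (n : ℝ) ^ 10 * (3 * (c₂ * n)) := by
      gcongr
      · linarith
      · linarith
    have h3 : 0 ≤ c₂ * (n : ℝ) ^ 11 := by positivity
    calc _ ≤ 14 * c₂ * (n : ℝ) ^ 11 := by linarith
      _ ≤ _ := by gcongr
  · have h1 : ((2 * (4 * n ^ 10) + 1 : ℕ) : ℝ) * G.diam ≤ (G.subdivide (4 * n ^ 10)).diam := by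
      exact_mod_cast le_diam_subdivide hm hG
    push_cast at h1
    refine le_trans ?_ h1
    have h2 : Real.log n ≤ C * G.diam := hdiam₁.trans (by gcongr)
    rw [mul_assoc, inv_mul_le_iff₀ hC0]
    calc (n : ℝ) ^ 10 * Real.log n ≤ (2 * (4 * (n : ℝ) ^ 10) + 1) * (C * G.diam) := by
          gcongr
          linarith
      _ = _ := by ring
  · have h1 : ((G.subdivide (4 * n ^ 10)).diam : ℝ) ≤
        ((2 * (4 * n ^ 10) + 1 : ℕ) : ℝ) * (G.diam + 1) := by
      exact_mod_cast diam_subdivide_le hm hG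
    push_cast at h1
    refine h1.trans ?_
    calc (2 * (4 * (n : ℝ) ^ 10) + 1) * (G.diam + 1) ≤ 9 * (n : ℝ) ^ 10 * (G.diam + 1) := by
          gcongr
          linarith
      _ ≤ 9 * (n : ℝ) ^ 10 * ((3 / Real.log 2 + 2 * (1 + |Real.log c₂| / Real.log 2) /
          Real.log (1 + ε / 6)) * Real.log n) := by gcongr
      _ = (9 * (3 / Real.log 2 + 2 * (1 + |Real.log c₂| / Real.log 2) / Real.log (1 + ε / 6))) *
          (n : ℝ) ^ 10 * Real.log n := by ring
      _ ≤ _ := by gcongr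
  · have h := le_spectralGap_subdivide hε hgap hdeg3 hk d₀
    refine le_trans ?_ h
    push_cast
    rw [← pow_mul]
    gcongr
  · have h := spectralGap_subdivide_le hk d₀
    refine h.trans ?_
    push_cast
    rw [← pow_mul]
    gcongr
  · intro k
    have h : ({v | (G.subdivide (4 * n ^ 10)).dist (Sum.inl a) v = k}.ncard : ℝ) ≤
        Fintype.card V + 2 * Fintype.card G.Dart := by
      exact_mod_cast ncard_sphere_subdivide_le hm hG a k
    have h2 : 14 * c₂ * n ≤ C * n := by gcongr
    have h3 : 0 ≤ c₂ * n := by positivity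
    linarith

/-- Given a trivalent expander family `(Z_n)` (all degrees 2 or 3, `#V(Z_n) ≈ n`,
`λ₁(Z_n) ≥ ε`), there are `C > 0` and rooted graphs `(Y_n, p_n)` of degree at most 3
with `#E(Y_n) ≈ n¹¹`, `diam Y_n ≈ n¹⁰ log n`, `λ₁(Y_n) ≈ n⁻²⁰`, and all distance
spheres about `p_n` of cardinality at most `C·n`. -/
theorem exists_model_graphs (ε c₁ c₂ : ℝ) (hε : 0 < ε) (hc₁ : 0 < c₁) (hc₂ : 0 < c₂)
    (Vz : ℕ → Type) [∀ n, Fintype (Vz n)] (Z : ∀ n, SimpleGraph (Vz n))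
    (hZconn : ∀ n : ℕ, 2 ≤ n → (Z n).Connected)
    (hZdeg : ∀ n : ℕ, 2 ≤ n → ∀ v : Vz n,
      ((Z n).neighborSet v).ncard = 2 ∨ ((Z n).neighborSet v).ncard = 3)
    (hZcard : ∀ n : ℕ, 2 ≤ n →
      c₁ * (n : ℝ) ≤ (Fintype.card (Vz n) : ℝ) ∧ (Fintype.card (Vz n) : ℝ) ≤ c₂ * (n : ℝ))
    (hZgap : ∀ n : ℕ, 2 ≤ n → ε ≤ spectralGap (Z n)) :
    ∃ C : ℝ, 0 < C ∧
      ∃ (Vy : ℕ → Type) (instVy : ∀ n, Fintype (Vy n))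
        (Y : ∀ n, SimpleGraph (Vy n)) (p : ∀ n, Vy n),
        ∀ n : ℕ, 2 ≤ n →
          (Y n).Connected ∧
          (∀ v : Vy n, ((Y n).neighborSet v).ncard ≤ 3) ∧
          (C⁻¹ * (n : ℝ) ^ 11 ≤ ((Y n).edgeSet.ncard : ℝ) ∧
            ((Y n).edgeSet.ncard : ℝ) ≤ C * (n : ℝ) ^ 11) ∧
          (C⁻¹ * (n : ℝ) ^ 10 * Real.log n ≤ ((Y n).diam : ℝ) ∧
            ((Y n).diam : ℝ) ≤ C * (n : ℝ) ^ 10 * Real.log n) ∧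
          (C⁻¹ / (n : ℝ) ^ 20 ≤ @spectralGap (Vy n) (instVy n) (Y n) ∧
            @spectralGap (Vy n) (instVy n) (Y n) ≤ C / (n : ℝ) ^ 20) ∧
          (∀ k : ℕ, ({v : Vy n | (Y n).dist (p n) v = k}.ncard : ℝ) ≤ C * (n : ℝ)) := by
  have hlog2 : 0 < Real.log 2 := Real.log_pos (by norm_num)
  have hlog4 : 0 < Real.log 4 := Real.log_pos (by norm_num)
  have hlogq : 0 < Real.log (1 + ε / 6) := Real.log_pos (by linarith)
  have h₁ : 0 < (8 * c₁)⁻¹ := by positivity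
  have h₃ : 0 < Real.log 4 + |Real.log c₁| := by positivity
  have h₄ : 0 < 9 * (3 / Real.log 2 +
    2 * (1 + |Real.log c₂| / Real.log 2) / Real.log (1 + ε / 6)) := by positivity
  have h₅ : 0 < (21 / ε + 12) * 16 := by positivity
  obtain ⟨C, hC⟩ : ∃ C, C = (8 * c₁)⁻¹ + 14 * c₂ + (Real.log 4 + |Real.log c₁|) +
    9 * (3 / Real.log 2 + 2 * (1 + |Real.log c₂| / Real.log 2) / Real.log (1 + ε / 6)) +
    (21 / ε + 12) * 16 + 5 := ⟨_, rfl⟩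
  have key : ∀ n : ℕ, ∃ (W : Type) (_ : Fintype W) (Y : SimpleGraph W) (p : W), 2 ≤ n →
      Y.Connected ∧
      (∀ v : W, (Y.neighborSet v).ncard ≤ 3) ∧
      (C⁻¹ * (n : ℝ) ^ 11 ≤ (Y.edgeSet.ncard : ℝ) ∧
        (Y.edgeSet.ncard : ℝ) ≤ C * (n : ℝ) ^ 11) ∧
      (C⁻¹ * (n : ℝ) ^ 10 * Real.log n ≤ (Y.diam : ℝ) ∧
        (Y.diam : ℝ) ≤ C * (n : ℝ) ^ 10 * Real.log n) ∧
      (C⁻¹ / (n : ℝ) ^ 20 ≤ spectralGap Y ∧ spectralGap Y ≤ C / (n : ℝ) ^ 20) ∧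
      (∀ k : ℕ, ({v : W | Y.dist p v = k}.ncard : ℝ) ≤ C * (n : ℝ)) := by
    intro n
    by_cases hn : 2 ≤ n
    · obtain ⟨W, inst, Y, p, h⟩ := subdivide_estimates (C := C) hε hc₁ hc₂ (Z n) hn (hZconn n hn)
        (hZdeg n hn) (hZcard n hn).1 (hZcard n hn).2 (hZgap n hn) (by linarith) (by linarith)
        (by linarith) (by linarith) (by linarith) (by linarith)
      exact ⟨W, inst, Y, p, fun _ => h⟩
    · exact ⟨Unit, inferInstance, ⊥, (), fun h => absurd h hn⟩
  choose Vy instVy Y p h using key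
  exact ⟨C, by linarith, Vy, instVy, Y, p, h⟩
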